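/- The sumset U + U + U equals ℕ \ {0, 1, 2, 3, 4, 5, 7, 8, 10, 13, 18, 26}; that is, a natural number n can be written as n = a + b + c with a, b, c ∈ U if and only if n ∉ {0, 1, 2, 3, 4, 5, 7, 8, 10, 13, 18, 26}. -/

import Mathlib

noncomputable def phi : ℝ := (1 + Real.sqrt 5) / 2

/-- The lower Wythoff set `L = {⌊i·φ⌋ : i ≥ 1}`. -/
def lowerWythoff : Set ℕ := {n | ∃ i : ℕ, 1 ≤ i ∧ n = ⌊(i : ℝ) * phi⌋₊}

/-- The upper Wythoff set `U = {⌊i·φ²⌋ : i ≥ 1}`. -/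
def upperWythoff : Set ℕ := {n | ∃ i : ℕ, 1 ≤ i ∧ n = ⌊(i : ℝ) * phi ^ 2⌋₊}

theorem phi_sq : phi ^ 2 = (3 + Real.sqrt 5) / 2 := by
  have h : Real.sqrt 5 ^ 2 = 5 := Real.sq_sqrt (by norm_num)
  unfold phi
  linear_combination h / 4

theorem floor_mul_phi_sq (i : ℕ) :
    ⌊(i : ℝ) * phi ^ 2⌋₊ = (3 * i + Nat.sqrt (5 * i ^ 2)) / 2 := by
  have h : (i : ℝ) * phi ^ 2 = (Real.sqrt ((5 * i ^ 2 : ℕ) : ℝ) + (3 * i : ℕ)) / (2 : ℕ) := by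
    have h5 : Real.sqrt ((5 * i ^ 2 : ℕ) : ℝ) = Real.sqrt 5 * i := by
      push_cast
      rw [Real.sqrt_mul (by norm_num), Real.sqrt_sq (Nat.cast_nonneg i)]
    rw [h5, phi_sq]
    push_cast
    ring
  rw [h, Nat.floor_div_natCast, Nat.floor_add_natCast (Real.sqrt_nonneg _),
    Real.nat_floor_real_sqrt_eq_nat_sqrt, add_comm]

theorem mem_upperWythoff_iff_range {n : ℕ} :
    n ∈ upperWythoff ↔ ∃ i ∈ Finset.range (n + 1), 1 ≤ i ∧ 3 * i ≤ 2 * n + 1 ∧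
      (2 * n - 3 * i) ^ 2 ≤ 5 * i ^ 2 ∧ 5 * i ^ 2 < (2 * n + 2 - 3 * i) ^ 2 := by
  simp only [upperWythoff, Set.mem_ofPred_eq, floor_mul_phi_sq, ← Nat.le_sqrt', ← Nat.sqrt_lt']
  constructor
  · rintro ⟨i, hi, h⟩
    exact ⟨i, Finset.mem_range.2 (by omega), by omega⟩
  · rintro ⟨i, -, hi, h⟩
    exact ⟨i, hi, by omega⟩

instance : DecidablePred (· ∈ upperWythoff) := fun _ =>
  decidable_of_iff' _ mem_upperWythoff_iff_range

/-- With `β = φ⁻² = (3 - √5) / 2`, an integer in `(mβ, (m + 1)β)` witnesses that `m` is an upper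
Wythoff number. -/
theorem mem_upperWythoff_of_int_between {m : ℕ} {j : ℤ}
    (h₁ : (m : ℝ) * ((3 - Real.sqrt 5) / 2) < j)
    (h₂ : (j : ℝ) < (m + 1) * ((3 - Real.sqrt 5) / 2)) : m ∈ upperWythoff := by
  have h5 : Real.sqrt 5 ^ 2 = 5 := Real.sq_sqrt (by norm_num)
  have hβ : 0 < (3 - Real.sqrt 5) / 2 := by nlinarith [Real.sqrt_nonneg 5]
  have hφ : 0 < phi ^ 2 := by rw [phi_sq]; positivity
  have hmul : (3 - Real.sqrt 5) / 2 * phi ^ 2 = 1 := by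
    rw [phi_sq]; linear_combination -h5 / 4
  have hj : 0 < j := by
    have : (0 : ℝ) < j := lt_of_le_of_lt (by positivity) h₁
    exact_mod_cast this
  lift j to ℕ using hj.le
  refine ⟨j, by omega, ?_⟩
  have h₁' := mul_lt_mul_of_pos_right h₁ hφ
  have h₂' := mul_lt_mul_of_pos_right h₂ hφ
  rw [mul_assoc, hmul, mul_one] at h₁' h₂'
  push_cast at h₁' h₂'
  exact ((Nat.floor_eq_iff (by positivity)).2 ⟨h₁'.le, h₂'⟩).symm

theorem exists_upperWythoff_sum_of_large {n : ℕ} (hn : 41 ≤ n) :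
    ∃ a ∈ upperWythoff, ∃ b ∈ upperWythoff, ∃ c ∈ upperWythoff, n = a + b + c := by
  have h5l : (2.236 : ℝ) < Real.sqrt 5 := Real.lt_sqrt_of_sq_lt (by norm_num)
  have h5u : Real.sqrt 5 < (2.2361 : ℝ) := (Real.sqrt_lt' (by norm_num)).2 (by norm_num)
  have h7 : 7 ∈ upperWythoff := by decide +kernel
  have h13 : 13 ∈ upperWythoff := by decide +kernel
  have h20 : 20 ∈ upperWythoff := by decide +kernel
  have key : ∀ (s : ℕ) (j : ℤ), s ≤ n →
      (n - s : ℝ) * ((3 - Real.sqrt 5) / 2) < j →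
      (j : ℝ) < (n - s + 1) * ((3 - Real.sqrt 5) / 2) → n - s ∈ upperWythoff := by
    intro s j hs h₁ h₂
    apply mem_upperWythoff_of_int_between (j := j) <;> rwa [Nat.cast_sub hs]
  obtain ⟨x, hx⟩ : ∃ x : ℝ, (n : ℝ) * ((3 - Real.sqrt 5) / 2) = x := ⟨_, rfl⟩
  have hl := Int.floor_le x
  have hu := Int.lt_floor_add_one x
  obtain ht | ht := le_or_gt ((⌊x⌋ : ℝ) + 1 - x) 0.1
  · exact ⟨20, h20, 20, h20, n - 40, key 40 (⌊x⌋ + 2 - 16) (by omega)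
      (by push_cast; linarith) (by push_cast; linarith), by omega⟩
  obtain ht | ht := le_or_gt ((⌊x⌋ : ℝ) + 1 - x) 0.4
  · exact ⟨13, h13, 13, h13, n - 26, key 26 (⌊x⌋ + 1 - 10) (by omega)
      (by push_cast; linarith) (by push_cast; linarith), by omega⟩
  obtain ht | ht := le_or_gt ((⌊x⌋ : ℝ) + 1 - x) 0.73
  · exact ⟨7, h7, 13, h13, n - 20, key 20 (⌊x⌋ + 1 - 8) (by omega)
      (by push_cast; linarith) (by push_cast; linarith), by omega⟩
  · exact ⟨20, h20, 20, h20, n - 40, key 40 (⌊x⌋ + 1 - 16) (by omega)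
      (by push_cast; linarith) (by push_cast; linarith), by omega⟩

theorem exists_upperWythoff_sum_iff_range {n : ℕ} :
    (∃ a ∈ upperWythoff, ∃ b ∈ upperWythoff, ∃ c ∈ upperWythoff, n = a + b + c) ↔
      ∃ a ∈ Finset.range (n + 1), a ∈ upperWythoff ∧ ∃ b ∈ Finset.range (n + 1 - a),
        b ∈ upperWythoff ∧ n - a - b ∈ upperWythoff := by
  constructor
  · rintro ⟨a, ha, b, hb, c, hc, rfl⟩
    refine ⟨a, Finset.mem_range.2 (by omega), ha, b, Finset.mem_range.2 (by omega), hb, ?_⟩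
    rwa [show a + b + c - a - b = c by omega]
  · rintro ⟨a, ha, ha', b, hb, hb', hc⟩
    rw [Finset.mem_range] at ha hb
    exact ⟨a, ha', b, hb', _, hc, by omega⟩

/-- Theorem 3.8(i): `U + U + U = ℕ \ {0, 1, 2, 3, 4, 5, 7, 8, 10, 13, 18, 26}`. -/
theorem upper_add_upper_add_upper (n : ℕ) :
    (∃ a ∈ upperWythoff, ∃ b ∈ upperWythoff, ∃ c ∈ upperWythoff, n = a + b + c) ↔
      n ∉ ({0, 1, 2, 3, 4, 5, 7, 8, 10, 13, 18, 26} : Set ℕ) := by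
  simp only [Set.mem_insert_iff, Set.mem_singleton_iff]
  obtain hn | hn := le_or_gt 41 n
  · exact iff_of_true (exists_upperWythoff_sum_of_large hn) (by omega)
  · rw [exists_upperWythoff_sum_iff_range]
    revert n
    decide +kernel
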